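/- Let 1 < p < 2 be a real number and N ≥ 1. Then there exists a constant c > 0 such that for all vectors ξ, ζ ∈ ℝ^N one has |ξ − ζ|^p ≤ c ⟨|ξ|^{p−2}ξ − |ζ|^{p−2}ζ, ξ − ζ⟩^{p/2} (|ξ|^p + |ζ|^p)^{(2−p)/2}, where |·| is the Euclidean norm, ⟨·,·⟩ the Euclidean inner product, all outer powers are real powers of nonnegative real numbers, and with the convention that |ξ|^{p−2}ξ = 0 when ξ = 0. -/

import Mathlib

open RealInnerProductSpace

/-- Quantitative monotonicity of `x ↦ ‖x‖ ^ (p - 2) • x` for `1 < p < 2`. -/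
theorem sub_one_mul_norm_sub_sq_le_inner_mul_rpow {E : Type*} [NormedAddCommGroup E]
    [InnerProductSpace ℝ E] {p : ℝ} (hp1 : 1 < p) (hp2 : p < 2) {x y : E} (hyx : ‖y‖ ≤ ‖x‖) :
    (p - 1) * ‖x - y‖ ^ 2 ≤
      ⟪‖x‖ ^ (p - 2) • x - ‖y‖ ^ (p - 2) • y, x - y⟫ * ‖x‖ ^ (2 - p) := by
  rcases eq_or_ne x 0 with rfl | hx
  · have hy : y = 0 := by simpa using hyx
    simp [hy]
  have ha : 0 < ‖x‖ := norm_pos_iff.2 hx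
  have hA : ‖x‖ ^ (p - 2) * ‖x‖ ^ (2 - p) = 1 := by
    rw [← Real.rpow_add ha]
    simp
  rcases eq_or_ne y 0 with rfl | hy
  · have : ⟪‖x‖ ^ (p - 2) • x, x⟫ * ‖x‖ ^ (2 - p) = ‖x‖ ^ 2 := by
      rw [real_inner_smul_left, real_inner_self_eq_norm_sq]
      linear_combination ‖x‖ ^ 2 * hA
    simp only [smul_zero, sub_zero, this]
    nlinarith [sq_nonneg ‖x‖]
  have hb : 0 < ‖y‖ := norm_pos_iff.2 hy
  set D := ‖y‖ ^ (p - 2) * ‖x‖ ^ (2 - p) with hD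
  have hD1 : 1 ≤ D := by
    rw [← hA, hD]
    gcongr ?_ * _
    exact Real.rpow_le_rpow_of_nonpos hb hyx (by linarith)
  have hDb : D * ‖y‖ ≤ (p - 1) * ‖y‖ + (2 - p) * ‖x‖ := by
    have h := Real.geom_mean_le_arith_mean2_weighted (w₁ := p - 1) (w₂ := 2 - p)
      (by linarith) (by linarith) hb.le ha.le (by ring)
    have hy1 : ‖y‖ ^ (p - 1) = ‖y‖ ^ (p - 2) * ‖y‖ := by
      rw [← Real.rpow_add_one hb.ne']
      ring_nf
    rw [hy1] at h
    linarith
  have ht : ⟪x, y⟫ ≤ ‖x‖ * ‖y‖ := real_inner_le_norm x y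
  have hinner : ⟪‖x‖ ^ (p - 2) • x - ‖y‖ ^ (p - 2) • y, x - y⟫ * ‖x‖ ^ (2 - p) =
      ‖x‖ ^ 2 + D * ‖y‖ ^ 2 - (1 + D) * ⟪x, y⟫ := by
    simp only [inner_sub_left, inner_sub_right, real_inner_smul_left,
      real_inner_self_eq_norm_sq, real_inner_comm x y]
    linear_combination (‖x‖ ^ 2 - ⟪x, y⟫) * hA
  rw [hinner, norm_sub_sq_real]
  have h₁ : 0 ≤ (1 + D - 2 * (p - 1)) * (‖x‖ * ‖y‖ - ⟪x, y⟫) :=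
    mul_nonneg (by linarith) (by linarith)
  have h₂ : 0 ≤ (‖x‖ - ‖y‖) * ((p - 1) * ‖y‖ + (2 - p) * ‖x‖ - D * ‖y‖) :=
    mul_nonneg (by linarith) (by linarith)
  linarith

/-- Simon's inequality with explicit constant, for vectors ordered by their norms. -/
theorem norm_sub_rpow_le_inner_rpow_mul_of_norm_le {E : Type*} [NormedAddCommGroup E]
    [InnerProductSpace ℝ E] {p : ℝ} (hp1 : 1 < p) (hp2 : p < 2) {x y : E} (hyx : ‖y‖ ≤ ‖x‖) :
    ‖x - y‖ ^ p ≤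
      ((p - 1)⁻¹) ^ (p / 2) * ⟪‖x‖ ^ (p - 2) • x - ‖y‖ ^ (p - 2) • y, x - y⟫ ^ (p / 2) *
        (‖x‖ ^ p + ‖y‖ ^ p) ^ ((2 - p) / 2) := by
  rcases eq_or_ne x 0 with rfl | hx
  · have hy : y = 0 := by simpa using hyx
    have h₀ : (0 : ℝ) ^ p = 0 := Real.zero_rpow (by linarith)
    have h₁ : (0 : ℝ) ^ (p / 2) = 0 := Real.zero_rpow (by linarith)
    simp [hy, h₀, h₁]
  have ha : 0 < ‖x‖ := norm_pos_iff.2 hx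
  have hp : 0 < p - 1 := by linarith
  have key := sub_one_mul_norm_sub_sq_le_inner_mul_rpow hp1 hp2 hyx
  set I := ⟪‖x‖ ^ (p - 2) • x - ‖y‖ ^ (p - 2) • y, x - y⟫
  have hC : 0 < ‖x‖ ^ (2 - p) := Real.rpow_pos_of_pos ha _
  have hI : 0 ≤ I := nonneg_of_mul_nonneg_left (le_trans (by positivity) key) hC
  calc ‖x - y‖ ^ p = (‖x - y‖ ^ 2) ^ (p / 2) := by
        rw [← Real.rpow_natCast_mul (norm_nonneg _)]
        congr 1
        push_cast
        ring
    _ ≤ ((p - 1)⁻¹ * I * ‖x‖ ^ (2 - p)) ^ (p / 2) := by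
        gcongr
        rw [mul_assoc, inv_mul_eq_div, le_div_iff₀ hp]
        linarith
    _ = ((p - 1)⁻¹) ^ (p / 2) * I ^ (p / 2) * (‖x‖ ^ p) ^ ((2 - p) / 2) := by
        rw [Real.mul_rpow (by positivity) hC.le, Real.mul_rpow (by positivity) hI,
          ← Real.rpow_mul ha.le, ← Real.rpow_mul ha.le]
        ring_nf
    _ ≤ _ := by
        gcongr
        exact le_add_of_nonneg_right (by positivity)

/-- Simon's inequality for 1 < p < 2: there is c > 0 such that for all
ξ, ζ ∈ ℝ^N,
‖ξ − ζ‖^p ≤ c ⟨‖ξ‖^{p−2}ξ − ‖ζ‖^{p−2}ζ, ξ − ζ⟩^{p/2} (‖ξ‖^p + ‖ζ‖^p)^{(2−p)/2}. -/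
theorem stmt_12 (p : ℝ) (hp1 : 1 < p) (hp2 : p < 2) (N : ℕ) (hN : 1 ≤ N) :
    ∃ c : ℝ, 0 < c ∧ ∀ ξ ζ : EuclideanSpace ℝ (Fin N),
      ‖ξ - ζ‖ ^ p ≤
        c * ⟪‖ξ‖ ^ (p - 2) • ξ - ‖ζ‖ ^ (p - 2) • ζ, ξ - ζ⟫ ^ (p / 2) *
          (‖ξ‖ ^ p + ‖ζ‖ ^ p) ^ ((2 - p) / 2) := by
  refine ⟨((p - 1)⁻¹) ^ (p / 2),
    Real.rpow_pos_of_pos (inv_pos.2 (by linarith)) _, fun ξ ζ => ?_⟩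
  rcases le_total ‖ζ‖ ‖ξ‖ with h | h
  · exact norm_sub_rpow_le_inner_rpow_mul_of_norm_le hp1 hp2 h
  · have := norm_sub_rpow_le_inner_rpow_mul_of_norm_le hp1 hp2 h
    rwa [norm_sub_rev, add_comm (‖ζ‖ ^ p), ← inner_neg_neg, neg_sub, neg_sub] at this
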